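/- Let w, σ, ℓ > 0, δ ≥ 0, a ∈ ℝ, and y₁, y₂ ∈ ℝ. Set ξ = ℓ²/(wσ(1+δ)), w̃ = w(1+δ)√(1+ξ²), σ̃ = σ(1+δ)√(1+ξ²), η = √(1 + σ²σ̃²/ℓ⁴), and c₁ = y₁/((1+δ)(1+ξ²)). Then ∫_{ℝ} exp(−i y₁' y₂/ℓ²) · N^w(y₁') · N^{ℓ²/(σ(1+δ))}( y₁' − y₁/(1+δ) ) · Φ₀^σ(y₁' − a) dy₁' = √(2π) · (σ/η) · N^{w̃}(y₁) · exp(−i c₁ y₂/ℓ²) · exp( −σ² y₂² / (2 ℓ⁴ η²) ) · Φ^{ηℓ²/σ̃}( −y₂/(η² ℓ²), c₁ − a ). -/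

import Mathlib

open MeasureTheory Complex

/-- The Gaussian `N^β(x) = exp(-x²/(2β²))`. -/
noncomputable def gaussN (β x : ℝ) : ℝ := Real.exp (-(x ^ 2) / (2 * β ^ 2))

/-- The truncated-Gaussian Fourier integral `Φ^σ(ω,u) = ∫_{-∞}^u exp(-iωx) N^σ(x) dx`. -/
noncomputable def Phi (σ ω u : ℝ) : ℂ :=
  ∫ x in Set.Iic u, Complex.exp (-Complex.I * ((ω * x : ℝ) : ℂ)) * ((gaussN σ x : ℝ) : ℂ)

/-- The product of two centred Gaussians evaluated at `z` and at the translate `z + t`, twisted by a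
character, integrates over `z` to a Gaussian in `t` twisted by a character. -/
lemma integral_cexp_mul_gaussN_mul_gaussN {s σ β : ℝ} (hs : 0 < s) (hσ : 0 < σ) (hβ : 0 < β)
    (h : β ^ 2 = s ^ 2 + σ ^ 2) (k t : ℝ) :
    ∫ z : ℝ, cexp (-I * ((k * z : ℝ) : ℂ)) * ((gaussN s z : ℝ) : ℂ) *
        ((gaussN σ (z + t) : ℝ) : ℂ) =
      ((Real.sqrt (2 * Real.pi) * (s * σ / β) : ℝ) : ℂ) *
        ((Real.exp (-(k ^ 2 * s ^ 2 * σ ^ 2) / (2 * β ^ 2)) : ℝ) : ℂ) *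
        (cexp (-I * ((-(k * s ^ 2 / β ^ 2) * t : ℝ) : ℂ)) * ((gaussN β t : ℝ) : ℂ)) := by
  have hs' : (s : ℂ) ≠ 0 := by exact_mod_cast hs.ne'
  have hσ' : (σ : ℂ) ≠ 0 := by exact_mod_cast hσ.ne'
  have hβ' : (β : ℂ) ≠ 0 := by exact_mod_cast hβ.ne'
  have h' : (β : ℂ) ^ 2 = s ^ 2 + σ ^ 2 := by exact_mod_cast h
  have h0 : (s : ℂ) ^ 2 + σ ^ 2 ≠ 0 := h' ▸ pow_ne_zero 2 hβ'
  set b : ℝ := -(β ^ 2 / (2 * s ^ 2 * σ ^ 2)) with hb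
  have hb0 : (b : ℂ).re < 0 := by
    rw [ofReal_re, hb, neg_lt_zero]
    positivity
  have key := integral_cexp_quadratic hb0 (-I * k - t / σ ^ 2) (-(t : ℂ) ^ 2 / (2 * σ ^ 2))
  have hlhs : ∀ z : ℝ, cexp (-I * ((k * z : ℝ) : ℂ)) * ((gaussN s z : ℝ) : ℂ) *
      ((gaussN σ (z + t) : ℝ) : ℂ) =
      cexp (b * z ^ 2 + (-I * k - t / σ ^ 2) * z + -(t : ℂ) ^ 2 / (2 * σ ^ 2)) := by
    intro z
    rw [gaussN, gaussN, ofReal_exp, ofReal_exp, ← Complex.exp_add, ← Complex.exp_add, hb]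
    congr 1
    push_cast
    rw [h']
    field_simp
    ring
  have hroot : ((Real.pi : ℂ) / -(b : ℂ)) ^ (1 / 2 : ℂ) =
      ((Real.sqrt (2 * Real.pi) * (s * σ / β) : ℝ) : ℂ) := by
    have h1 : ((Real.pi : ℂ) / -(b : ℂ)) = ((2 * Real.pi * (s * σ / β) ^ 2 : ℝ) : ℂ) := by
      rw [hb]
      push_cast
      field_simp
    have h2 : (1 / 2 : ℂ) = ((1 / 2 : ℝ) : ℂ) := by norm_num
    rw [h1, h2, ← ofReal_cpow (by positivity), ← Real.sqrt_eq_rpow,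
      Real.sqrt_mul (by positivity), Real.sqrt_sq (by positivity)]
  simp_rw [hlhs]
  rw [key, hroot, mul_assoc, gaussN, ofReal_exp, ofReal_exp, ← Complex.exp_add, ← Complex.exp_add,
    hb]
  congr 2
  push_cast
  rw [h']
  field_simp
  ring_nf
  simp only [I_sq]
  ring

lemma continuous_gaussN (β : ℝ) : Continuous (gaussN β) := by
  unfold gaussN
  fun_prop

lemma integrable_gaussN {β : ℝ} (hβ : 0 < β) : Integrable (gaussN β) := by
  have hb : (0 : ℝ) < 1 / (2 * β ^ 2) := by positivity
  refine (integrable_exp_neg_mul_sq hb).congr (.of_forall fun x => ?_)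
  simp only [gaussN]
  congr 1
  ring

/-- The Fourier–Gaussian-cumulative identity. -/
lemma integral_cexp_mul_gaussN_mul_integral_Iic {s σ β : ℝ} (hs : 0 < s) (hσ : 0 < σ)
    (hβ : 0 < β) (h : β ^ 2 = s ^ 2 + σ ^ 2) (k u : ℝ) :
    ∫ z : ℝ, cexp (-I * ((k * z : ℝ) : ℂ)) * ((gaussN s z : ℝ) : ℂ) *
        ((∫ t in Set.Iic (z + u), gaussN σ t : ℝ) : ℂ) =
      ((Real.sqrt (2 * Real.pi) * (s * σ / β) : ℝ) : ℂ) *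
        ((Real.exp (-(k ^ 2 * s ^ 2 * σ ^ 2) / (2 * β ^ 2)) : ℝ) : ℂ) *
        Phi β (-(k * s ^ 2 / β ^ 2)) u := by
  have hshift : ∀ z : ℝ, ∫ t in Set.Iic (z + u), gaussN σ t =
      ∫ t in Set.Iic u, gaussN σ (z + t) := by
    intro z
    have := (measurePreserving_add_left volume z).setIntegral_preimage_emb
      (MeasurableEquiv.addLeft z).measurableEmbedding (gaussN σ) (Set.Iic (z + u))
    rw [← this]
    congr 2
    ext t
    simp
  have hint : Integrable (Function.uncurry fun z t : ℝ => cexp (-I * ((k * z : ℝ) : ℂ)) *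
      ((gaussN s z : ℝ) : ℂ) * ((gaussN σ (z + t) : ℝ) : ℂ))
      (volume.prod (volume.restrict (Set.Iic u))) := by
    have h1 : Integrable (fun p : ℝ × ℝ => gaussN s p.1 * gaussN σ (p.1 + p.2))
        (volume.prod volume) :=
      (measurePreserving_prod_add volume volume).integrable_comp_of_integrable
        ((integrable_gaussN hs).mul_prod (integrable_gaussN hσ))
    have h2 : Integrable (fun p : ℝ × ℝ => gaussN s p.1 * gaussN σ (p.1 + p.2))
        (volume.prod (volume.restrict (Set.Iic u))) :=
      h1.mono_measure (Measure.prod_mono le_rfl Measure.restrict_le_self)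
    have hs' := continuous_gaussN s
    have hσ' := continuous_gaussN σ
    refine h2.mono (Continuous.aestronglyMeasurable ?_) (.of_forall fun p => ?_)
    · simp only [Function.uncurry_def]
      fun_prop
    · have : ‖cexp (-I * ((k * p.1 : ℝ) : ℂ))‖ = 1 := by
        rw [neg_mul, mul_comm, ← neg_mul, ← ofReal_neg, norm_exp_ofReal_mul_I]
      simp only [Function.uncurry_def, norm_mul, this, one_mul, norm_real, le_refl]
  simp_rw [hshift, ← integral_complex_ofReal, ← integral_const_mul]
  rw [integral_integral_swap hint, Phi, ← integral_const_mul]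
  simp_rw [integral_cexp_mul_gaussN_mul_gaussN hs hσ hβ h]

/-- The product rule for two Gaussians. -/
lemma gaussN_mul_gaussN_sub {w v s W d m y : ℝ} (hw : 0 < w) (hv : 0 < v) (hd : d ≠ 0)
    (hs : s ^ 2 * (w ^ 2 + v ^ 2) = w ^ 2 * v ^ 2) (hW : W ^ 2 = d ^ 2 * (w ^ 2 + v ^ 2))
    (hm : m = y / d * (w ^ 2 / (w ^ 2 + v ^ 2))) (x : ℝ) :
    gaussN w x * gaussN v (x - y / d) = gaussN W y * gaussN s (x - m) := by
  have hs2 : s ^ 2 = w ^ 2 * v ^ 2 / (w ^ 2 + v ^ 2) := by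
    rw [← hs]
    field_simp
  simp only [gaussN]
  rw [← Real.exp_add, ← Real.exp_add, hW, hs2, hm]
  congr 1
  field_simp
  ring

/-- Final evaluation step of the strip contribution: combining the Gaussian product rule
with the Fourier–Gaussian-cumulative identity yields a closed form with the parameters
`η`, `σ̃`, `w̃`, `c₁` of the main approximation theorem. -/
theorem strip_contribution_closed_form
    (w σ ℓ : ℝ) (hw : 0 < w) (hσ : 0 < σ) (hℓ : 0 < ℓ)
    (δ : ℝ) (hδ : 0 ≤ δ) (a y₁ y₂ : ℝ)
    (ξ wt σt η c₁ : ℝ)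
    (hξ : ξ = ℓ ^ 2 / (w * σ * (1 + δ)))
    (hwt : wt = w * (1 + δ) * Real.sqrt (1 + ξ ^ 2))
    (hσt : σt = σ * (1 + δ) * Real.sqrt (1 + ξ ^ 2))
    (hη : η = Real.sqrt (1 + σ ^ 2 * σt ^ 2 / ℓ ^ 4))
    (hc₁ : c₁ = y₁ / ((1 + δ) * (1 + ξ ^ 2))) :
    (∫ x : ℝ, Complex.exp (-Complex.I * ((x * y₂ / ℓ ^ 2 : ℝ) : ℂ)) *
        ((gaussN w x : ℝ) : ℂ) *
        ((gaussN (ℓ ^ 2 / (σ * (1 + δ))) (x - y₁ / (1 + δ)) : ℝ) : ℂ) *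
        ((∫ x' in Set.Iic (x - a), gaussN σ x' : ℝ) : ℂ)) =
      ((Real.sqrt (2 * Real.pi) * (σ / η) : ℝ) : ℂ) * ((gaussN wt y₁ : ℝ) : ℂ) *
        Complex.exp (-Complex.I * ((c₁ * y₂ / ℓ ^ 2 : ℝ) : ℂ)) *
        ((Real.exp (-(σ ^ 2 * y₂ ^ 2) / (2 * ℓ ^ 4 * η ^ 2)) : ℝ) : ℂ) *
        Phi (η * ℓ ^ 2 / σt) (-(y₂ / (η ^ 2 * ℓ ^ 2))) (c₁ - a) := by
  have hd : 0 < 1 + δ := by linarith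
  have hξ0 : 0 < ξ := by rw [hξ]; positivity
  have hσt0 : 0 < σt := by rw [hσt]; positivity
  have hη0 : 0 < η := by rw [hη]; positivity
  have hwt2 : wt ^ 2 = w ^ 2 * (1 + δ) ^ 2 * (1 + ξ ^ 2) := by
    rw [hwt, mul_pow, mul_pow, Real.sq_sqrt (by positivity)]
  have hσt2 : σt ^ 2 = σ ^ 2 * (1 + δ) ^ 2 * (1 + ξ ^ 2) := by
    rw [hσt, mul_pow, mul_pow, Real.sq_sqrt (by positivity)]
  have hη2 : η ^ 2 = 1 + σ ^ 2 * σt ^ 2 / ℓ ^ 4 := by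
    rw [hη, Real.sq_sqrt (by positivity)]
  have hv : 0 < ℓ ^ 2 / (σ * (1 + δ)) := by positivity
  have hs : 0 < ℓ ^ 2 / σt := by positivity
  have hβ : 0 < η * ℓ ^ 2 / σt := by positivity
  have hβ2 : (η * ℓ ^ 2 / σt) ^ 2 = (ℓ ^ 2 / σt) ^ 2 + σ ^ 2 := by
    rw [div_pow, mul_pow, hη2]
    field_simp
  have hvξ : ℓ ^ 2 / (σ * (1 + δ)) = w * ξ := by
    rw [hξ]
    field_simp
  have hprod : ∀ z : ℝ,
      gaussN w (z + c₁) * gaussN (ℓ ^ 2 / (σ * (1 + δ))) (z + c₁ - y₁ / (1 + δ)) =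
      gaussN wt y₁ * gaussN (ℓ ^ 2 / σt) z := by
    intro z
    have := gaussN_mul_gaussN_sub (s := ℓ ^ 2 / σt) (W := wt) (m := c₁) (y := y₁) hw hv
      hd.ne' ?_ ?_ ?_ (z + c₁)
    · rwa [add_sub_cancel_right] at this
    · have hℓ2 : ℓ ^ 2 = w * ξ * (σ * (1 + δ)) := by rw [← hvξ]; field_simp
      rw [hvξ, div_pow, hσt2, hℓ2]
      field_simp
    · rw [hvξ, hwt2]
      ring
    · rw [hvξ, hc₁]
      field_simp
  rw [← integral_add_right_eq_self _ c₁]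
  have hpt : ∀ z : ℝ, cexp (-I * (((z + c₁) * y₂ / ℓ ^ 2 : ℝ) : ℂ)) *
        ((gaussN w (z + c₁) : ℝ) : ℂ) *
        ((gaussN (ℓ ^ 2 / (σ * (1 + δ))) (z + c₁ - y₁ / (1 + δ)) : ℝ) : ℂ) *
        ((∫ x' in Set.Iic (z + c₁ - a), gaussN σ x' : ℝ) : ℂ) =
      ((gaussN wt y₁ : ℝ) : ℂ) * cexp (-I * ((c₁ * y₂ / ℓ ^ 2 : ℝ) : ℂ)) *
        (cexp (-I * ((y₂ / ℓ ^ 2 * z : ℝ) : ℂ)) * ((gaussN (ℓ ^ 2 / σt) z : ℝ) : ℂ) *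
          ((∫ x' in Set.Iic (z + (c₁ - a)), gaussN σ x' : ℝ) : ℂ)) := by
    intro z
    have hexp : cexp (-I * (((z + c₁) * y₂ / ℓ ^ 2 : ℝ) : ℂ)) =
        cexp (-I * ((c₁ * y₂ / ℓ ^ 2 : ℝ) : ℂ)) * cexp (-I * ((y₂ / ℓ ^ 2 * z : ℝ) : ℂ)) := by
      rw [← Complex.exp_add]
      congr 1
      push_cast
      ring
    rw [mul_assoc (cexp _) _ ((gaussN _ _ : ℝ) : ℂ), ← ofReal_mul, hprod, hexp,
      ofReal_mul (gaussN wt y₁), add_sub_assoc]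
    ring
  simp_rw [hpt]
  rw [integral_const_mul, integral_cexp_mul_gaussN_mul_integral_Iic hs hσ hβ hβ2]
  have e1 : ℓ ^ 2 / σt * σ / (η * ℓ ^ 2 / σt) = σ / η := by field_simp
  have e2 : -((y₂ / ℓ ^ 2) ^ 2 * (ℓ ^ 2 / σt) ^ 2 * σ ^ 2) / (2 * (η * ℓ ^ 2 / σt) ^ 2) =
      -(σ ^ 2 * y₂ ^ 2) / (2 * ℓ ^ 4 * η ^ 2) := by field_simp
  have e3 : y₂ / ℓ ^ 2 * (ℓ ^ 2 / σt) ^ 2 / (η * ℓ ^ 2 / σt) ^ 2 = y₂ / (η ^ 2 * ℓ ^ 2) := by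
    field_simp
  rw [e1, e2, e3]
  ring
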